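/- After Matchday 4, under the goal-difference tiebreak, a team D is certain to finish fourth if and only if the current points of every other team exceed the current points of D by at least 7. -/

import Mathlib

/-- Teams are the elements of `Fin 4`. -/
abbrev Team : Type := Fin 4

/-- A complete tournament assigns to each ordered pair `(i, j)` (with `i` at home)
a result `(goals scored by i, goals scored by j)`.  Only values at pairs of
distinct teams are meaningful. -/
abbrev Tournament : Type := Team → Team → ℕ × ℕ

/-- Points obtained in a single match by a team scoring `g` goals and conceding `c`. -/
def matchPts (g c : ℕ) : ℕ := if c < g then 3 else if g = c then 1 else 0

/-- The set of all 12 ordered matches. -/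
def allMatches : Finset (Team × Team) := Finset.univ.filter (fun m => m.1 ≠ m.2)

/-- Points of team `i` summed over the matches in `P` (the played matches). -/
def currentPts (P : Finset (Team × Team)) (T : Tournament) (i : Team) : ℕ :=
  ∑ m ∈ P,
    (if m.1 = i then matchPts (T m.1 m.2).1 (T m.1 m.2).2
     else if m.2 = i then matchPts (T m.1 m.2).2 (T m.1 m.2).1
     else 0)

/-- Total points of team `i` in a complete tournament. -/
def totalPts (T : Tournament) (i : Team) : ℕ := currentPts allMatches T i

/-- Goal difference of team `i` in a complete tournament. -/
def goalDiff (T : Tournament) (i : Team) : ℤ :=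
  ∑ m ∈ allMatches,
    (if m.1 = i then ((T m.1 m.2).1 : ℤ) - ((T m.1 m.2).2 : ℤ)
     else if m.2 = i then ((T m.1 m.2).2 : ℤ) - ((T m.1 m.2).1 : ℤ)
     else 0)

/-- Points obtained by team `i` in its two mutual matches against team `j`. -/
def mutualPts (T : Tournament) (i j : Team) : ℕ :=
  matchPts (T i j).1 (T i j).2 + matchPts (T j i).2 (T j i).1

/-- Goal difference of team `i` in its two mutual matches against team `j`. -/
def mutualGD (T : Tournament) (i j : Team) : ℤ :=
  (((T i j).1 : ℤ) - ((T i j).2 : ℤ)) + (((T j i).2 : ℤ) - ((T j i).1 : ℤ))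

/-- Goal-difference tiebreak: `i` is ranked strictly above `j`. -/
def RankedAboveGD (T : Tournament) (i j : Team) : Prop :=
  totalPts T j < totalPts T i ∨
    (totalPts T i = totalPts T j ∧ goalDiff T j < goalDiff T i)

/-- Head-to-head tiebreak: `i` is ranked strictly above `j`. -/
def RankedAboveH2H (T : Tournament) (i j : Team) : Prop :=
  totalPts T j < totalPts T i ∨
    (totalPts T i = totalPts T j ∧ mutualPts T j i < mutualPts T i j) ∨
    (totalPts T i = totalPts T j ∧ mutualPts T i j = mutualPts T j i ∧
      mutualGD T j i < mutualGD T i j)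

open Classical in
/-- Final position of team `i` under the goal-difference tiebreak. -/
noncomputable def finalPosGD (T : Tournament) (i : Team) : ℕ :=
  1 + (Finset.univ.filter (fun j => RankedAboveGD T j i)).card

open Classical in
/-- Final position of team `i` under the head-to-head tiebreak. -/
noncomputable def finalPosH2H (T : Tournament) (i : Team) : ℕ :=
  1 + (Finset.univ.filter (fun j => RankedAboveH2H T j i)).card

/-- `T'` is a completion of the partial tournament `(P, T)`. -/
def Completes (P : Finset (Team × Team)) (T T' : Tournament) : Prop :=
  ∀ m ∈ P, T' m.1 m.2 = T m.1 m.2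

/-- The set `P` of played matches corresponds to the situation after Matchday 4:
every unordered pair of distinct teams has at least one of its ordered matches
played, and exactly two unordered pairs — which are disjoint, forming a perfect
matching of the four teams — have both of their ordered matches played. -/
def AfterMD4 (P : Finset (Team × Team)) : Prop :=
  (∀ m ∈ P, m.1 ≠ m.2) ∧
  (∀ i j : Team, i ≠ j → (i, j) ∈ P ∨ (j, i) ∈ P) ∧
  ∃ a b c d : Team,
    ({a, b, c, d} : Finset Team) = Finset.univ ∧
    (a, b) ∈ P ∧ (b, a) ∈ P ∧ (c, d) ∈ P ∧ (d, c) ∈ P ∧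
    ∀ i j : Team, (i, j) ∈ P → (j, i) ∈ P →
      ({i, j} : Finset Team) = {a, b} ∨ ({i, j} : Finset Team) = {c, d}

/-- After Matchday 4 every team `D` has exactly one opponent `e` against whom both matches
have been played. -/
lemma AfterMD4.exists_partner {P : Finset (Team × Team)} (hP : AfterMD4 P) (D : Team) :
    ∃ e, e ≠ D ∧ ∀ j, j ≠ D → (((D, j) ∈ P ∧ (j, D) ∈ P) ↔ j = e) := by
  obtain ⟨hne, -, a, b, c, d, huniv, hab, hba, hcd, hdc, honly⟩ := hP
  have hdist : ∀ a b c d : Team, ({a, b, c, d} : Finset Team) = Finset.univ →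
      a ≠ b ∧ a ≠ c ∧ a ≠ d ∧ b ≠ c ∧ b ≠ d ∧ c ≠ d := by decide
  obtain ⟨h₁, h₂, h₃, h₄, h₅, h₆⟩ := hdist a b c d huniv
  have hD : D ∈ ({a, b, c, d} : Finset Team) := huniv ▸ Finset.mem_univ D
  have hmem : ∀ j, (D, j) ∈ P → (j, D) ∈ P →
      (D = a ∨ D = b) ∧ (j = a ∨ j = b) ∨ (D = c ∨ D = d) ∧ (j = c ∨ j = d) := by
    intro j h h'
    have hDj : D ∈ ({D, j} : Finset Team) := by simp
    have hj : j ∈ ({D, j} : Finset Team) := by simp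
    rcases honly D j h h' with heq | heq <;> rw [heq] at hDj hj <;> simp_all
  clear honly hdist huniv hne
  simp only [Finset.mem_insert, Finset.mem_singleton] at hD
  rcases hD with rfl | rfl | rfl | rfl
  · exact ⟨b, by grind⟩
  · exact ⟨a, by grind⟩
  · exact ⟨d, by grind⟩
  · exact ⟨c, by grind⟩

/-- After Matchday 4 every team has exactly two unplayed matches. -/
lemma AfterMD4.sum_unplayed {P : Finset (Team × Team)} (hP : AfterMD4 P) (D : Team)
    {M : Type*} [AddCommMonoid M] (x : M) :
    ∑ m ∈ allMatches \ P, (if m.1 = D then x else if m.2 = D then x else 0) = 2 • x := by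
  obtain ⟨e, heD, he⟩ := hP.exists_partner D
  have hor : ∀ j, j ≠ D → (D, j) ∈ P ∨ (j, D) ∈ P := fun j hj => hP.2.1 D j hj.symm
  have hcard : (((allMatches \ P).filter fun m => m.1 = D ∨ m.2 = D)).card = 2 := by
    have himage : ((Finset.univ.erase D).erase e).image
        (fun j => if (D, j) ∈ P then (j, D) else (D, j)) =
        (allMatches \ P).filter fun m => m.1 = D ∨ m.2 = D := by
      ext ⟨i, j⟩
      simp only [allMatches, Finset.mem_image, Finset.mem_erase, Finset.mem_filter,
        Finset.mem_sdiff, Finset.mem_univ, true_and, and_true]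
      grind
    rw [← himage, Finset.card_image_of_injOn, Finset.card_erase_of_mem, Finset.card_erase_of_mem]
    · rfl
    · simp
    · simp [heD]
    · intro j hj k hk h
      simp only [Finset.coe_erase, Set.mem_sdiff, Set.mem_singleton_iff] at hj hk
      grind
  rw [← hcard, ← Finset.sum_const, Finset.sum_filter]
  refine Finset.sum_congr rfl fun m _ => ?_
  split_ifs <;> simp_all

lemma AfterMD4.subset_allMatches {P : Finset (Team × Team)} (hP : AfterMD4 P) :
    P ⊆ allMatches := fun m hm => by simpa [allMatches] using hP.1 m hm

lemma matchPts_le_three (g c : ℕ) : matchPts g c ≤ 3 := by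
  unfold matchPts; split_ifs <;> omega

lemma Completes.currentPts_eq {P : Finset (Team × Team)} {T T' : Tournament}
    (h : Completes P T T') (i : Team) : currentPts P T' i = currentPts P T i := by
  unfold currentPts
  exact Finset.sum_congr rfl fun m hm => by rw [h m hm]

lemma Completes.totalPts_eq {P : Finset (Team × Team)} {T T' : Tournament}
    (h : Completes P T T') (hP : AfterMD4 P) (i : Team) :
    totalPts T' i = currentPts (allMatches \ P) T' i + currentPts P T i := by
  rw [← h.currentPts_eq i]
  unfold totalPts currentPts
  exact (Finset.sum_sdiff hP.subset_allMatches).symm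

/-- Goal difference of team `i` over the matches in `P`. -/
def currentGD (P : Finset (Team × Team)) (T : Tournament) (i : Team) : ℤ :=
  ∑ m ∈ P,
    (if m.1 = i then ((T m.1 m.2).1 : ℤ) - ((T m.1 m.2).2 : ℤ)
     else if m.2 = i then ((T m.1 m.2).2 : ℤ) - ((T m.1 m.2).1 : ℤ)
     else 0)

lemma Completes.goalDiff_eq {P : Finset (Team × Team)} {T T' : Tournament}
    (h : Completes P T T') (hP : AfterMD4 P) (i : Team) :
    goalDiff T' i = currentGD (allMatches \ P) T' i + currentGD P T i := by
  have hcur : currentGD P T' i = currentGD P T i := by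
    unfold currentGD
    exact Finset.sum_congr rfl fun m hm => by rw [h m hm]
  rw [← hcur]
  unfold goalDiff currentGD
  exact (Finset.sum_sdiff hP.subset_allMatches).symm

lemma AfterMD4.currentPts_unplayed_le {P : Finset (Team × Team)} (hP : AfterMD4 P)
    (T : Tournament) (i : Team) : currentPts (allMatches \ P) T i ≤ 6 := by
  refine le_trans (Finset.sum_le_sum fun m _ => ?_) (hP.sum_unplayed i (3 : ℕ)).le
  split_ifs
  · exact matchPts_le_three _ _
  · exact matchPts_le_three _ _
  · exact le_rfl

/-- The completion of `(P, T)` in which `D` wins every remaining match by `N` goals to nil and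
`j` loses every remaining match. -/
def extremeCompletion (P : Finset (Team × Team)) (T : Tournament) (D j : Team) (N : ℕ) :
    Tournament := fun x y =>
  if (x, y) ∈ P then T x y
  else if x = D then (N, 0)
  else if y = D then (0, N)
  else if x = j then (0, 1)
  else if y = j then (1, 0)
  else (0, 0)

section extremeCompletion

variable {P : Finset (Team × Team)} {T : Tournament} {D j : Team} {N : ℕ}

lemma completes_extremeCompletion : Completes P T (extremeCompletion P T D j N) :=
  fun m hm => by simp [extremeCompletion, hm]

lemma currentPts_extremeCompletion_winner (hP : AfterMD4 P) (hN : 0 < N) :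
    currentPts (allMatches \ P) (extremeCompletion P T D j N) D = 6 := by
  refine Eq.trans (Finset.sum_congr rfl fun m hm => ?_) (hP.sum_unplayed D (3 : ℕ))
  have hmP : (m.1, m.2) ∉ P := (Finset.mem_sdiff.mp hm).2
  split_ifs with h₁ h₂
  · simp [extremeCompletion, matchPts, hN, hmP, if_pos h₁]
  · simp [extremeCompletion, matchPts, hN, hmP, if_neg h₁, if_pos h₂]
  · rfl

lemma currentGD_extremeCompletion_winner (hP : AfterMD4 P) :
    currentGD (allMatches \ P) (extremeCompletion P T D j N) D = 2 * N := by
  refine Eq.trans (Finset.sum_congr rfl fun m hm => ?_)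
    ((hP.sum_unplayed D (N : ℤ)).trans (by simp))
  have hmP : (m.1, m.2) ∉ P := (Finset.mem_sdiff.mp hm).2
  split_ifs with h₁ h₂
  · simp [extremeCompletion, hmP, if_pos h₁]
  · simp [extremeCompletion, hmP, if_neg h₁, if_pos h₂]
  · rfl

lemma currentPts_extremeCompletion_loser (hN : 0 < N) (hj : j ≠ D) :
    currentPts (allMatches \ P) (extremeCompletion P T D j N) j = 0 := by
  refine Finset.sum_eq_zero fun m hm => ?_
  have hm' := Finset.mem_sdiff.mp hm
  have hne : m.1 ≠ m.2 := by simpa [allMatches] using hm'.1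
  have hmP : (m.1, m.2) ∉ P := hm'.2
  simp only [extremeCompletion, matchPts, hmP, if_false]
  grind

lemma currentGD_extremeCompletion_loser (hj : j ≠ D) :
    currentGD (allMatches \ P) (extremeCompletion P T D j N) j ≤ 0 := by
  refine Finset.sum_nonpos fun m hm => ?_
  have hm' := Finset.mem_sdiff.mp hm
  have hne : m.1 ≠ m.2 := by simpa [allMatches] using hm'.1
  have hmP : (m.1, m.2) ∉ P := hm'.2
  simp only [extremeCompletion, hmP, if_false]
  grind

end extremeCompletion

/-- After Matchday 4, under the goal-difference tiebreak, team `D`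
is certain to finish fourth iff the current points of every other team exceed
the current points of `D` by at least 7. -/
theorem certainFourth_GD_iff
    (P : Finset (Team × Team)) (T : Tournament) (hP : AfterMD4 P) (D : Team) :
    (∀ T' : Tournament, Completes P T T' → ∀ j : Team, j ≠ D → RankedAboveGD T' j D) ↔
    (∀ j : Team, j ≠ D → currentPts P T D + 7 ≤ currentPts P T j) := by
  constructor
  · intro h j hj
    set N : ℕ := (currentGD P T j - currentGD P T D).natAbs + 1 with hNdef
    have hN : 0 < N := Nat.succ_pos _
    have hC : Completes P T (extremeCompletion P T D j N) := completes_extremeCompletion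
    have hlose := currentGD_extremeCompletion_loser (P := P) (T := T) (N := N) hj
    have habove := h _ hC j hj
    rw [RankedAboveGD, hC.totalPts_eq hP, hC.totalPts_eq hP, hC.goalDiff_eq hP,
      hC.goalDiff_eq hP, currentPts_extremeCompletion_winner hP hN,
      currentPts_extremeCompletion_loser hN hj, currentGD_extremeCompletion_winner hP] at habove
    omega
  · intro h T' hT' j hj
    left
    rw [hT'.totalPts_eq hP, hT'.totalPts_eq hP]
    have hgap := h j hj
    have hmax := hP.currentPts_unplayed_le T' D
    omega
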